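/- Every trivial real Lie superalgebra L of dimension 4 with nonzero odd part has trivial Bogomolov multiplier B̃₀(L) = 0. In particular B̃₀ vanishes for all Backhouse classes of types (3,1), (2,2) and (1,3); for example for L³(3,1) = ⟨a,b,c | α : [a,c]=pa−b, [b,c]=a+pb, [c,α]=qα, q ≠ 0⟩, for L⁶(2,2) = ⟨a,b | α,β : [a,b]=b, [a,α]=(p+1)α, [a,β]=pβ, [b,β]=α⟩, and for L⁴(1,3) = ⟨a | α,β,γ : [a,α]=pα, [a,β]=qβ−γ, [a,γ]=β+qγ, q ≥ 0, p ≠ 0⟩. -/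

import Mathlib

/-!
Basic definitions for Lie superalgebras over a commutative ring `K`,
graded ideals, the nonabelian (CP) exterior products and the Bogomolov multiplier.
-/

universe u v

namespace BogomolovSuper

/-- The sign `(-1)^{|i||j|}` attached to a pair of `ℤ₂`-degrees. -/
def sgn (i j : ZMod 2) : ℤ := (-1) ^ (i.val * j.val)

/-- A Lie superalgebra structure on a `K`-module `L`: a `ℤ₂`-grading
`gr` with `L = gr 0 ⊕ gr 1` together with a super bracket satisfying
super skew-symmetry, the super Jacobi identity and `[x,x] = 0` for even `x`. -/
structure SuperAlg (K : Type u) [CommRing K] (L : Type v)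
    [AddCommGroup L] [Module K L] where
  bk : L →ₗ[K] L →ₗ[K] L
  gr : ZMod 2 → Submodule K L
  gr_inf : gr 0 ⊓ gr 1 = ⊥
  gr_sup : gr 0 ⊔ gr 1 = ⊤
  bk_gr : ∀ i j : ZMod 2, ∀ x ∈ gr i, ∀ y ∈ gr j, bk x y ∈ gr (i + j)
  skew : ∀ i j : ZMod 2, ∀ x ∈ gr i, ∀ y ∈ gr j, bk x y = -(sgn i j • bk y x)
  jacobi : ∀ i j : ZMod 2, ∀ x ∈ gr i, ∀ y ∈ gr j, ∀ z : L,
    bk x (bk y z) = bk (bk x y) z + sgn i j • bk y (bk x z)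
  even_sq : ∀ x ∈ gr 0, bk x x = 0

variable {K : Type u} [CommRing K]

section Defs

variable {L L' E : Type v} [AddCommGroup L] [Module K L]
  [AddCommGroup L'] [Module K L'] [AddCommGroup E] [Module K E]

/-- A homomorphism of Lie superalgebras of even degree (degree zero). -/
def IsSuperHom (s : SuperAlg K L) (s' : SuperAlg K L') (f : L →ₗ[K] L') : Prop :=
  (∀ x y : L, f (s.bk x y) = s'.bk (f x) (f y)) ∧
  (∀ i : ZMod 2, ∀ x ∈ s.gr i, f x ∈ s'.gr i)

/-- A graded (homogeneous) ideal of a Lie superalgebra. -/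
def IsGradedIdeal (s : SuperAlg K L) (M : Submodule K L) : Prop :=
  (∀ x : L, ∀ m ∈ M, s.bk x m ∈ M ∧ s.bk m x ∈ M) ∧
  (∀ m ∈ M, ∃ m₀ ∈ M ⊓ s.gr 0, ∃ m₁ ∈ M ⊓ s.gr 1, m = m₀ + m₁)

/-- The sub-Lie-superalgebra generated by a set: the smallest submodule
containing the set and closed under the bracket. -/
def lieSpan (s : SuperAlg K E) (S : Set E) : Submodule K E :=
  sInf {p : Submodule K E | S ⊆ p ∧ ∀ x ∈ p, ∀ y ∈ p, s.bk x y ∈ p}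

/-- `K(L)`: the set of all brackets `[a,b]`. -/
def bkSet (s : SuperAlg K L) : Set L := {x : L | ∃ a b : L, x = s.bk a b}

/-- The derived subalgebra `L² = [L,L]` (as a submodule; it is a graded ideal). -/
def derived (s : SuperAlg K L) : Submodule K L := Submodule.span K (bkSet s)

/-- The descending central series of a Lie superalgebra. -/
def lcs (s : SuperAlg K L) : ℕ → Submodule K L
  | 0 => ⊤
  | n + 1 => Submodule.span K {x : L | ∃ a ∈ lcs s n, ∃ b : L, x = s.bk a b}

/-- Nilpotency of a Lie superalgebra. -/
def IsNilpotentSuper (s : SuperAlg K L) : Prop := ∃ c : ℕ, lcs s c = ⊥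

/-- A Lie super exterior pairing on a pair of graded ideals `M`, `N` of `(L, s)`,
with values in a Lie superalgebra `(E, t)`. -/
structure IsExtPairing (s : SuperAlg K L) (M N : Submodule K L)
    (t : SuperAlg K E) (ρ : L → L → E) : Prop where
  grade : ∀ i j : ZMod 2, ∀ m ∈ M ⊓ s.gr i, ∀ n ∈ N ⊓ s.gr j, ρ m n ∈ t.gr (i + j)
  smul_left : ∀ (c : K) (i j : ZMod 2), ∀ m ∈ M ⊓ s.gr i, ∀ n ∈ N ⊓ s.gr j,
    ρ (c • m) n = c • ρ m n
  smul_right : ∀ (c : K) (i j : ZMod 2), ∀ m ∈ M ⊓ s.gr i, ∀ n ∈ N ⊓ s.gr j,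
    ρ m (c • n) = c • ρ m n
  add_left : ∀ (i j : ZMod 2), ∀ m ∈ M ⊓ s.gr i, ∀ m' ∈ M ⊓ s.gr i, ∀ n ∈ N ⊓ s.gr j,
    ρ (m + m') n = ρ m n + ρ m' n
  add_right : ∀ (i j : ZMod 2), ∀ m ∈ M ⊓ s.gr i, ∀ n ∈ N ⊓ s.gr j, ∀ n' ∈ N ⊓ s.gr j,
    ρ m (n + n') = ρ m n + ρ m n'
  bk_left : ∀ (i i' j : ZMod 2), ∀ m ∈ M ⊓ s.gr i, ∀ m' ∈ M ⊓ s.gr i', ∀ n ∈ N ⊓ s.gr j,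
    ρ (s.bk m m') n = ρ m (s.bk m' n) - sgn i i' • ρ m' (s.bk m n)
  bk_right : ∀ (i j j' : ZMod 2), ∀ m ∈ M ⊓ s.gr i, ∀ n ∈ N ⊓ s.gr j, ∀ n' ∈ N ⊓ s.gr j',
    ρ m (s.bk n n') = sgn j' (i + j) • ρ (s.bk n' m) n - sgn i j • ρ (s.bk n m) n'
  bk_pair : ∀ (i j i' j' : ZMod 2), ∀ m ∈ M ⊓ s.gr i, ∀ n ∈ N ⊓ s.gr j,
    ∀ m' ∈ M ⊓ s.gr i', ∀ n' ∈ N ⊓ s.gr j',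
    t.bk (ρ m n) (ρ m' n') = -(sgn i j • ρ (s.bk n m) (s.bk m' n'))

/-- A Lie super `B̃₀`-pairing: an exterior pairing that moreover kills the
commutativity-preserving relations. -/
structure IsB0Pairing (s : SuperAlg K L) (M N : Submodule K L)
    (t : SuperAlg K E) (ρ : L → L → E)
    extends IsExtPairing s M N t ρ : Prop where
  rel_pair : ∀ (i j i' j' : ZMod 2), ∀ m ∈ M ⊓ s.gr i, ∀ n ∈ N ⊓ s.gr j,
    ∀ m' ∈ M ⊓ s.gr i', ∀ n' ∈ N ⊓ s.gr j',
    s.bk m n + sgn i' j' • s.bk m' n' = 0 → ρ m n + sgn i' j' • ρ m' n' = 0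
  rel_even : ∀ m ∈ M ⊓ s.gr 0, ∀ n ∈ N ⊓ s.gr 0, s.bk m n = 0 → ρ m n = 0

/-- The set of wedge generators `m ∧ n` (`m`, `n` homogeneous). -/
def wedgeSet (s : SuperAlg K L) (M N : Submodule K L) (ρ : L → L → E) : Set E :=
  {e : E | ∃ i j : ZMod 2, ∃ m ∈ M ⊓ s.gr i, ∃ n ∈ N ⊓ s.gr j, e = ρ m n}

/-- `(E, t, ρ)` is the nonabelian exterior product `M ∧ N`: `ρ` is a universal
exterior pairing whose image generates `E`. -/
structure IsExtProduct (s : SuperAlg K L) (M N : Submodule K L)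
    (t : SuperAlg K E) (ρ : L → L → E) : Prop where
  pairing : IsExtPairing s M N t ρ
  gen : Submodule.span K (wedgeSet s M N ρ) = ⊤
  lift : ∀ {E' : Type v} [AddCommGroup E'] [Module K E'],
    ∀ (t' : SuperAlg K E') (ρ' : L → L → E'), IsExtPairing s M N t' ρ' →
    ∃ f : E →ₗ[K] E', IsSuperHom t t' f ∧
      ∀ (i j : ZMod 2), ∀ m ∈ M ⊓ s.gr i, ∀ n ∈ N ⊓ s.gr j, f (ρ m n) = ρ' m n

/-- `(E, t, ρ)` is the commutativity preserving (CP) exterior product `M ⋏ N`: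
`ρ` is a universal `B̃₀`-pairing whose image generates `E`. -/
structure IsCPProduct (s : SuperAlg K L) (M N : Submodule K L)
    (t : SuperAlg K E) (ρ : L → L → E) : Prop where
  pairing : IsB0Pairing s M N t ρ
  gen : Submodule.span K (wedgeSet s M N ρ) = ⊤
  lift : ∀ {E' : Type v} [AddCommGroup E'] [Module K E'],
    ∀ (t' : SuperAlg K E') (ρ' : L → L → E'), IsB0Pairing s M N t' ρ' →
    ∃ f : E →ₗ[K] E', IsSuperHom t t' f ∧
      ∀ (i j : ZMod 2), ∀ m ∈ M ⊓ s.gr i, ∀ n ∈ N ⊓ s.gr j, f (ρ m n) = ρ' m n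

/-- Generators of `M₀(M,N)` inside the exterior product. -/
def M0Set (s : SuperAlg K L) (M N : Submodule K L) (ρ : L → L → E) : Set E :=
  {e : E | ∃ i j i' j' : ZMod 2, ∃ m ∈ M ⊓ s.gr i, ∃ n ∈ N ⊓ s.gr j,
      ∃ m' ∈ M ⊓ s.gr i', ∃ n' ∈ N ⊓ s.gr j',
      s.bk m n + sgn i' j' • s.bk m' n' = 0 ∧ e = ρ m n + sgn i' j' • ρ m' n'} ∪
  {e : E | ∃ m ∈ M ⊓ s.gr 0, ∃ n ∈ N ⊓ s.gr 0, s.bk m n = 0 ∧ e = ρ m n}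

/-- `M₀(M,N)`, the graded submodule of the exterior product generated
by the commutativity-preserving relations. -/
def M0 (s : SuperAlg K L) (M N : Submodule K L) (ρ : L → L → E) : Submodule K E :=
  Submodule.span K (M0Set s M N ρ)

/-- `κ` is the commutator map `κ̃ : m ∧ n ↦ [m,n]`. -/
def IsCommMap (s : SuperAlg K L) (M N : Submodule K L) (ρ : L → L → E)
    (κ : E →ₗ[K] L) : Prop :=
  ∀ (i j : ZMod 2), ∀ m ∈ M ⊓ s.gr i, ∀ n ∈ N ⊓ s.gr j, κ (ρ m n) = s.bk m n

/-- The Bogomolov multiplier `B̃₀(L) = M(L)/M₀(L)` of `(L,s)` is trivial: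
for any realization of the exterior product `L ∧ L` and of the commutator
map `κ̃`, the kernel `M(L)` of `κ̃` is contained in `M₀(L)`. -/
def HasTrivialBog (s : SuperAlg K L) : Prop :=
  ∀ {E' : Type v} [AddCommGroup E'] [Module K E'],
    ∀ (t : SuperAlg K E') (w : L → L → E'), IsExtProduct s ⊤ ⊤ t w →
    ∀ κ : E' →ₗ[K] L, IsCommMap s ⊤ ⊤ w κ → LinearMap.ker κ ≤ M0 s ⊤ ⊤ w

end Defs

section Free

variable {F : Type v} [AddCommGroup F] [Module K F]

/-- `(F, sF)` is the free Lie superalgebra on the `ℤ₂`-graded set `X`. -/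
structure IsFreeSuper (sF : SuperAlg K F) (X : ZMod 2 → Set F) : Prop where
  subset : ∀ i : ZMod 2, X i ⊆ sF.gr i
  gen : lieSpan sF (X 0 ∪ X 1) = ⊤
  lift : ∀ {M : Type v} [AddCommGroup M] [Module K M],
    ∀ (sM : SuperAlg K M) (f : F → M), (∀ i : ZMod 2, ∀ x ∈ X i, f x ∈ sM.gr i) →
    ∃ g : F →ₗ[K] M, IsSuperHom sF sM g ∧ ∀ x ∈ X 0 ∪ X 1, g x = f x

end Free

end BogomolovSuper

namespace BogomolovSuper

/-- A space of dimension at most `n` is spanned by a family indexed by `Fin n`. -/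
lemma exists_fin_family_span_eq_top {V : Type*} [AddCommGroup V] [Module ℝ V]
    [FiniteDimensional ℝ V] {n : ℕ} (h : Module.finrank ℝ V ≤ n) :
    ∃ e : Fin n → V, Submodule.span ℝ (Set.range e) = ⊤ := by
  classical
  let b := Module.finBasis ℝ V
  refine ⟨fun i => if hi : (i : ℕ) < Module.finrank ℝ V then b ⟨i, hi⟩ else 0, ?_⟩
  rw [eq_top_iff, ← b.span_eq, Submodule.span_le]
  rintro _ ⟨j, rfl⟩
  exact Submodule.subset_span ⟨⟨j, j.2.trans_le h⟩, by simp⟩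

/-- Sums of values of a bilinear map on a space of dimension at most `2` reduce to two values. -/
lemma exists_eq_add_of_mem_span_of_finrank_le_two {V W Q : Type*}
    [AddCommGroup V] [Module ℝ V] [FiniteDimensional ℝ V] [AddCommGroup W] [Module ℝ W]
    [AddCommGroup Q] [Module ℝ Q] (B : V →ₗ[ℝ] W →ₗ[ℝ] Q) (h : Module.finrank ℝ V ≤ 2)
    {x : Q} (hx : x ∈ Submodule.span ℝ {q | ∃ v w, q = B v w}) :
    ∃ v w v' w', x = B v w + B v' w' := by
  obtain ⟨e, he⟩ := exists_fin_family_span_eq_top h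
  have hle : Submodule.span ℝ {q | ∃ v w, q = B v w} ≤
      LinearMap.range ((B (e 0)).coprod (B (e 1))) := by
    rw [Submodule.span_le]
    rintro _ ⟨v, w, rfl⟩
    have hv : v ∈ Submodule.span ℝ (Set.range e) := he ▸ Submodule.mem_top
    obtain ⟨c, rfl⟩ := (Submodule.mem_span_range_iff_exists_fun ℝ).1 hv
    exact ⟨(c 0 • w, c 1 • w), by simp [Fin.sum_univ_two]⟩
  obtain ⟨⟨w, w'⟩, rfl⟩ := hle hx
  exact ⟨e 0, w, e 1, w', rfl⟩

/-- Sums of values of an alternating bilinear map on a space of dimension at most `3` reduce to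
two values. -/
lemma exists_eq_add_of_mem_span_of_finrank_le_three {V Q : Type*}
    [AddCommGroup V] [Module ℝ V] [FiniteDimensional ℝ V]
    [AddCommGroup Q] [Module ℝ Q] (B : V →ₗ[ℝ] V →ₗ[ℝ] Q) (hB : B.IsAlt)
    (h : Module.finrank ℝ V ≤ 3)
    {x : Q} (hx : x ∈ Submodule.span ℝ {q | ∃ v w, q = B v w}) :
    ∃ v w v' w', x = B v w + B v' w' := by
  obtain ⟨e, he⟩ := exists_fin_family_span_eq_top h
  have hle : Submodule.span ℝ {q | ∃ v w, q = B v w} ≤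
      LinearMap.range ((B (e 0)).coprod (B (e 1))) := by
    rw [Submodule.span_le]
    rintro _ ⟨v, w, rfl⟩
    have hv : v ∈ Submodule.span ℝ (Set.range e) := he ▸ Submodule.mem_top
    have hw : w ∈ Submodule.span ℝ (Set.range e) := he ▸ Submodule.mem_top
    obtain ⟨c, rfl⟩ := (Submodule.mem_span_range_iff_exists_fun ℝ).1 hv
    obtain ⟨d, rfl⟩ := (Submodule.mem_span_range_iff_exists_fun ℝ).1 hw
    refine ⟨(c 0 • (d 1 • e 1 + d 2 • e 2) - d 0 • (c 1 • e 1 + c 2 • e 2),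
      (c 1 * d 2 - c 2 * d 1) • e 2), ?_⟩
    have h10 := hB.neg (e 0) (e 1)
    have h20 := hB.neg (e 0) (e 2)
    have h21 := hB.neg (e 1) (e 2)
    simp only [LinearMap.coprod_apply, Fin.sum_univ_three, map_add, map_sub, map_smul,
      LinearMap.add_apply, LinearMap.smul_apply, hB (e 0), hB (e 1), hB (e 2), ← h10, ← h20, ← h21]
    module
  obtain ⟨⟨w, w'⟩, rfl⟩ := hle hx
  exact ⟨e 0, w, e 1, w', rfl⟩

section Pairing

variable {K : Type u} [CommRing K] {L E : Type v} [AddCommGroup L] [Module K L]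
  [AddCommGroup E] [Module K E] {s : SuperAlg K L} {t : SuperAlg K E} {ρ : L → L → E}

/-- An exterior pairing on `L` is bilinear on each pair of homogeneous components. -/
def IsExtPairing.component (h : IsExtPairing s ⊤ ⊤ t ρ) (i j : ZMod 2) :
    s.gr i →ₗ[K] s.gr j →ₗ[K] E :=
  LinearMap.mk₂ K (fun m n => ρ m n)
    (fun m m' n => h.add_left i j _ ⟨trivial, m.2⟩ _ ⟨trivial, m'.2⟩ _ ⟨trivial, n.2⟩)
    (fun c m n => h.smul_left c i j _ ⟨trivial, m.2⟩ _ ⟨trivial, n.2⟩)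
    (fun m n n' => h.add_right i j _ ⟨trivial, m.2⟩ _ ⟨trivial, n.2⟩ _ ⟨trivial, n'.2⟩)
    (fun c m n => h.smul_right c i j _ ⟨trivial, m.2⟩ _ ⟨trivial, n.2⟩)

@[simp]
lemma IsExtPairing.component_apply (h : IsExtPairing s ⊤ ⊤ t ρ) (i j : ZMod 2)
    (m : s.gr i) (n : s.gr j) : h.component i j m n = ρ m n := rfl

lemma IsCommMap.apply {κ : E →ₗ[K] L} (hκ : IsCommMap s ⊤ ⊤ ρ κ) {i j : ZMod 2}
    (m : s.gr i) (n : s.gr j) : κ (ρ m n) = s.bk m n :=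
  hκ i j m ⟨trivial, m.2⟩ n ⟨trivial, n.2⟩

lemma IsCommMap.M0_le_ker {κ : E →ₗ[K] L} (hκ : IsCommMap s ⊤ ⊤ ρ κ) :
    M0 s ⊤ ⊤ ρ ≤ LinearMap.ker κ := by
  refine Submodule.span_le.2 ?_
  rintro _ (⟨i, j, i', j', m, hm, n, hn, m', hm', n', hn', h, rfl⟩ | ⟨m, hm, n, hn, h, rfl⟩)
  · simpa [hκ i j m hm n hn, hκ i' j' m' hm' n' hn'] using h
  · simpa [hκ 0 0 m hm n hn] using h

/-- `M₀(L)` contains the sum of two wedges whose brackets cancel, provided the second wedge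
involves an even factor. -/
lemma add_mem_M0 {i j i' j' : ZMod 2} (hs : sgn i' j' = 1) (m : s.gr i) (n : s.gr j)
    (m' : s.gr i') (n' : s.gr j') (h : s.bk m n + s.bk m' n' = 0) :
    ρ m n + ρ m' n' ∈ M0 s ⊤ ⊤ ρ :=
  Submodule.subset_span <| Or.inl ⟨i, j, i', j', m, ⟨trivial, m.2⟩, n, ⟨trivial, n.2⟩,
    m', ⟨trivial, m'.2⟩, n', ⟨trivial, n'.2⟩, by simpa [hs] using h, by simp [hs]⟩

/-- `M₀(L)` contains the wedges of homogeneous elements with vanishing bracket. -/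
lemma IsExtPairing.mem_M0 (h : IsExtPairing s ⊤ ⊤ t ρ) {i j : ZMod 2} (m : s.gr i) (n : s.gr j)
    (hmn : s.bk m n = 0) : ρ m n ∈ M0 s ⊤ ⊤ ρ := by
  have h0 : ρ ((0 : s.gr 0) : L) ((0 : s.gr 0) : L) = 0 := by
    rw [← h.component_apply 0 0, map_zero]
  simpa only [h0, add_zero] using add_mem_M0 (ρ := ρ) (s := s) (i' := 0) (j' := 0) (by simp [sgn])
    m n 0 0 (by simpa using hmn)

end Pairing

/-- Every trivial real Lie superalgebra `L` of dimension `4`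
with nonzero odd part (i.e. `[L₁, L₁] = 0` and `L₁ ≠ 0`; by Backhouse's
classification these are exactly the algebras of types `(3,1)`, `(2,2)` and
`(1,3)` listed in the paper, e.g. `L³_{(3,1)}`, `L⁶_{(2,2)}` and `L⁴_{(1,3)}`)
has trivial Bogomolov multiplier `B̃₀(L) = 0`. -/
theorem trivial_real_dim_four_trivial_bogomolov
    {L : Type v} [AddCommGroup L] [Module ℝ L] [FiniteDimensional ℝ L]
    (s : SuperAlg ℝ L)
    (hdim : Module.finrank ℝ L = 4)
    (hodd : s.gr 1 ≠ ⊥)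
    (htriv : ∀ u ∈ s.gr 1, ∀ v ∈ s.gr 1, s.bk u v = 0) :
    HasTrivialBog s := by
  intro E _ _ t w hw κ hκ x hx
  have hp := hw.pairing
  set q := (M0 s ⊤ ⊤ w).mkQ
  have hsum : Module.finrank ℝ (s.gr 0) + Module.finrank ℝ (s.gr 1) = 4 := by
    rw [← Submodule.finrank_sup_add_finrank_inf_eq, s.gr_sup, s.gr_inf, finrank_top, hdim,
      finrank_bot]
  have hdeg : ∀ i : ZMod 2, i = 0 ∨ i = 1 := by decide
  have hpos : Module.finrank ℝ (s.gr 1) ≠ 0 := by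
    rwa [Ne, Submodule.finrank_eq_zero]
  let B₀ := (hp.component 0 0).compr₂ q
  let B₁ := (hp.component 0 1).compr₂ q
  have hdecomp : q x ∈ Submodule.span ℝ {y | ∃ m n, y = B₀ m n} ⊔
      Submodule.span ℝ {y | ∃ m n, y = B₁ m n} := by
    have hmem : x ∈ Submodule.span ℝ (wedgeSet s ⊤ ⊤ w) := hw.gen ▸ Submodule.mem_top
    rw [← Submodule.mem_comap]
    refine Submodule.span_le.2 ?_ hmem
    rintro _ ⟨i, j, m, ⟨-, hm⟩, n, ⟨-, hn⟩, rfl⟩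
    simp only [SetLike.mem_coe, Submodule.mem_comap]
    obtain rfl | rfl := hdeg i
    all_goals obtain rfl | rfl := hdeg j
    · exact Submodule.mem_sup_left (Submodule.subset_span ⟨⟨m, hm⟩, ⟨n, hn⟩, rfl⟩)
    · exact Submodule.mem_sup_right (Submodule.subset_span ⟨⟨m, hm⟩, ⟨n, hn⟩, rfl⟩)
    · have hswap : w m n + w n m ∈ M0 s ⊤ ⊤ w :=
        add_mem_M0 (by simp [sgn]) (⟨m, hm⟩ : s.gr 1) (⟨n, hn⟩ : s.gr 0)
          (⟨n, hn⟩ : s.gr 0) (⟨m, hm⟩ : s.gr 1) (by simp [s.skew 1 0 m hm n hn, sgn])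
      have hneg : q (w m n) = -q (w n m) := by
        rw [← add_eq_zero_iff_eq_neg, ← map_add]
        exact (Submodule.Quotient.mk_eq_zero _).2 hswap
      rw [hneg]
      exact neg_mem <| Submodule.mem_sup_right (Submodule.subset_span ⟨⟨n, hn⟩, ⟨m, hm⟩, rfl⟩)
    · have hzero : q (w m n) = 0 := (Submodule.Quotient.mk_eq_zero _).2 <|
        hp.mem_M0 (⟨m, hm⟩ : s.gr 1) (⟨n, hn⟩ : s.gr 1) (htriv m hm n hn)
      rw [hzero]
      exact zero_mem _
  obtain ⟨y₀, hy₀, y₁, hy₁, hy⟩ := Submodule.mem_sup.1 hdecomp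
  have halt : B₀.IsAlt := fun m =>
    (Submodule.Quotient.mk_eq_zero _).2 (hp.mem_M0 m m (s.even_sq m m.2))
  obtain ⟨a, b, c, d, rfl⟩ :=
    exists_eq_add_of_mem_span_of_finrank_le_three B₀ halt (by omega) hy₀
  have hy₁' : ∃ m n m' n', y₁ = B₁ m n + B₁ m' n' := by
    by_cases h : Module.finrank ℝ (s.gr 0) ≤ 2
    · exact exists_eq_add_of_mem_span_of_finrank_le_two B₁ h hy₁
    · obtain ⟨n, m, n', m', rfl⟩ := exists_eq_add_of_mem_span_of_finrank_le_two B₁.flip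
        (x := y₁) (by omega) (Submodule.span_mono (by rintro _ ⟨m, n, rfl⟩; exact ⟨n, m, rfl⟩) hy₁)
      exact ⟨m, n, m', n', rfl⟩
  obtain ⟨m, n, m', n', rfl⟩ := hy₁'
  have hdiff : (w a b + w c d + (w m n + w m' n')) - x ∈ M0 s ⊤ ⊤ w := by
    rw [← Submodule.Quotient.mk_eq_zero, ← Submodule.mkQ_apply, map_sub, sub_eq_zero]
    exact hy
  have hbk : s.bk a b + s.bk c d + (s.bk m n + s.bk m' n') = 0 := by
    have := hκ.M0_le_ker hdiff
    rw [LinearMap.mem_ker, map_sub, LinearMap.mem_ker.1 hx, sub_zero] at this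
    simpa only [map_add, hκ.apply] using this
  have hdisj := Submodule.disjoint_def.1 (disjoint_iff.2 s.gr_inf)
  have h0 : s.bk a b + s.bk c d = 0 := by
    refine hdisj _ (add_mem (s.bk_gr 0 0 a a.2 b b.2) (s.bk_gr 0 0 c c.2 d d.2)) ?_
    rw [eq_neg_of_add_eq_zero_left hbk]
    exact neg_mem (add_mem (s.bk_gr 0 1 m m.2 n n.2) (s.bk_gr 0 1 m' m'.2 n' n'.2))
  have h1 : s.bk m n + s.bk m' n' = 0 := by rwa [h0, zero_add] at hbk
  exact (Submodule.sub_mem_iff_right _ (add_mem (add_mem_M0 (by simp [sgn]) a b c d h0)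
    (add_mem_M0 (by simp [sgn]) m n m' n' h1))).1 hdiff

end BogomolovSuper
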